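/- arXiv:1506.00241 — 6 statements merged into one kernel-verified Lean document; each statement's English description precedes it below -/
import Mathlib

section
/- A continuous function f : ℝ → M into a complete metric space (M,d) is Bohr almost periodic if and only if it is Bochner almost periodic, i.e. for every sequence (α'_n) of real numbers there exists a subsequence (α_n) such that the translates f(· + α_n) converge uniformly on ℝ. -/
open Filter Topology Set

/-- A set `T ⊆ ℝ` is relatively dense if there is `l > 0` such that every open
interval `(a, a+l)` contains a point of `T`. -/
def RelativelyDense (T : Set ℝ) : Prop :=
  ∃ l > 0, ∀ a : ℝ, ∃ τ ∈ Set.Ioo a (a + l), τ ∈ T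

/-- `f : ℝ → M` is Bohr almost periodic: for every `ε > 0`,
the set of `ε`-almost periods of `f` is relatively dense in `ℝ`. -/
def IsBohrAP {M : Type*} [PseudoMetricSpace M] (f : ℝ → M) : Prop :=
  ∀ ε > 0, RelativelyDense {τ : ℝ | ∀ t : ℝ, dist (f (t + τ)) (f t) < ε}

theorem IsBohrAP.uniformContinuous' {M : Type*} [MetricSpace M] {f : ℝ → M}
    (hf : Continuous f) (h : IsBohrAP f) : UniformContinuous f := by
  rw [Metric.uniformContinuous_iff]
  intro ε hε
  obtain ⟨l, hl, H⟩ := h (ε / 3) (by positivity)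
  have hc := (isCompact_Icc (a := (-1 : ℝ)) (b := l + 1)).uniformContinuousOn_of_continuous
    hf.continuousOn
  rw [Metric.uniformContinuousOn_iff] at hc
  obtain ⟨δ, hδ, hc⟩ := hc (ε / 3) (by positivity)
  refine ⟨min δ 1, by positivity, fun {a b} hab => ?_⟩
  obtain ⟨τ, ⟨h1, h2⟩, hτ⟩ := H (-a)
  have hab1 := lt_of_lt_of_le hab (min_le_left _ _)
  have hab2 := lt_of_lt_of_le hab (min_le_right _ _)
  rw [Real.dist_eq, abs_lt] at hab2
  have h3 := hc (a + τ) ⟨by linarith, by linarith⟩ (b + τ) ⟨by linarith, by linarith⟩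
    (by simpa using hab1)
  have h4 := hτ a
  have h5 := hτ b
  have h6 := dist_triangle4 (f a) (f (a + τ)) (f (b + τ)) (f b)
  rw [dist_comm (f a) (f (a + τ))] at h6
  linarith

theorem IsBohrAP.totallyBounded' {M : Type*} [MetricSpace M] {f : ℝ → M}
    (hf : Continuous f) (h : IsBohrAP f) :
    TotallyBounded (Set.range fun a : ℝ => UniformFun.ofFun fun t : ℝ => f (t + a)) := by
  have hu := Metric.uniformContinuous_iff.1 (h.uniformContinuous' hf)
  have hb := UniformFun.hasBasis_uniformity_of_basis ℝ M (Metric.uniformity_basis_dist (α := M))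
  rw [hb.totallyBounded_iff]
  intro ε hε
  obtain ⟨l, hl, H⟩ := h (ε / 2) (by positivity)
  obtain ⟨δ, hδ, hu⟩ := hu (ε / 2) (by positivity)
  obtain ⟨s, -, hs, hcov⟩ := Metric.finite_approx_of_totallyBounded
    (isCompact_Icc (a := (0 : ℝ)) (b := l)).totallyBounded δ hδ
  refine ⟨(fun a : ℝ => UniformFun.ofFun fun t : ℝ => f (t + a)) '' s, hs.image _, ?_⟩
  rintro _ ⟨a, rfl⟩
  obtain ⟨τ, ⟨h1, h2⟩, hτ⟩ := H (-a)
  have hm : a + τ ∈ Set.Icc 0 l := ⟨by linarith, by linarith⟩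
  obtain ⟨y, hy, hd⟩ := Set.mem_iUnion₂.1 (hcov hm)
  refine Set.mem_iUnion₂.2 ⟨_, Set.mem_image_of_mem _ hy, ?_⟩
  intro t
  change dist (f (t + a)) (f (t + y)) < ε
  have h3 := hτ (t + a)
  have h4 : dist (f (t + (a + τ))) (f (t + y)) < ε / 2 := hu (by simpa using hd)
  rw [dist_comm, add_assoc] at h3
  linarith [dist_triangle (f (t + a)) (f (t + (a + τ))) (f (t + y))]

/-- A continuous function into a complete metric space is Bohr almost periodic if and
only if it is Bochner almost periodic: from every sequence of reals one can extract a
subsequence along which the translates of `f` converge uniformly on `ℝ`. -/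
theorem bohrAP_iff_bochnerAP {M : Type*} [MetricSpace M] [CompleteSpace M]
    (f : ℝ → M) (hf : Continuous f) :
    IsBohrAP f ↔
      ∀ α' : ℕ → ℝ, ∃ φ : ℕ → ℕ, StrictMono φ ∧
        ∃ g : ℝ → M, TendstoUniformly (fun n t => f (t + α' (φ n))) g atTop := by
  constructor
  · intro h α'
    have hc := (h.totallyBounded' hf).closure.isCompact_of_isClosed isClosed_closure
    obtain ⟨g, -, φ, hφ, hg⟩ := hc.isSeqCompact
      (x := fun n => UniformFun.ofFun fun t : ℝ => f (t + α' n))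
      (fun n => subset_closure ⟨α' n, rfl⟩)
    refine ⟨φ, hφ, UniformFun.toFun g, ?_⟩
    exact UniformFun.tendsto_iff_tendstoUniformly.1 hg
  · intro h ε hε
    by_contra hT
    unfold RelativelyDense at hT
    push Not at hT
    obtain ⟨α, -, hα⟩ := exists_seq_of_forall_finset_exists (fun _ : ℝ => True)
      (fun x y => y - x ∉ {τ : ℝ | ∀ t : ℝ, dist (f (t + τ)) (f t) < ε}) (by
        intro s _
        obtain ⟨R, hR⟩ := (s.finite_toSet.image (fun x : ℝ => |x|)).bddAbove
        obtain ⟨a, ha⟩ := hT (2 * |R| + 1) (by positivity)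
        refine ⟨a + |R| + 1 / 2, trivial, fun x hx => ha _ ?_⟩
        have h1 : |x| ≤ |R| := (hR ⟨x, hx, rfl⟩).trans (le_abs_self R)
        rw [abs_le] at h1
        exact ⟨by linarith, by linarith⟩)
    obtain ⟨φ, hφ, g, hg⟩ := h α
    obtain ⟨N, hN⟩ := eventually_atTop.1 (Metric.tendstoUniformly_iff.1 hg (ε / 2) (by positivity))
    refine hα (φ N) (φ (N + 1)) (hφ (Nat.lt_succ_self N)) fun t => ?_
    have h1 := hN N le_rfl (t - α (φ N))
    have h2 := hN (N + 1) (Nat.le_succ N) (t - α (φ N))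
    rw [sub_add_cancel] at h1
    rw [show t - α (φ N) + α (φ (N + 1)) = t + (α (φ (N + 1)) - α (φ N)) by ring] at h2
    linarith [dist_triangle_left (f (t + (α (φ (N + 1)) - α (φ N)))) (f t) (g (t - α (φ N)))]
end

section
/- Let D ⊆ ℝ^d be open and f : ℝ × D → ℝ^d be continuous. Then f is almost periodic in t uniformly for x ∈ D if and only if for every pair of sequences (α'_n) and (β'_n) of real numbers there exist common subsequences (α_k = α'_{n_k}) and (β_k = β'_{n_k}) (extracted along the same index sequence n_k) such that for every compact set S ⊆ D: the functions (t,x) ↦ f(t + α_k + β_k, x) converge uniformly on ℝ × S to a function h, the functions (t,x) ↦ f(t + β_k, x) converge uniformly on ℝ × S to a function g, the functions (t,x) ↦ g(t + α_k, x) converge uniformly on ℝ × S, and their limit equals h. -/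
open Filter Topology Set

/-- `f(t,x)` is almost periodic in `t` uniformly for `x ∈ D`. -/
def IsUniformlyAP {d : ℕ} (D : Set (EuclideanSpace ℝ (Fin d)))
    (f : ℝ × EuclideanSpace ℝ (Fin d) → EuclideanSpace ℝ (Fin d)) : Prop :=
  ∀ ε > 0, ∀ S : Set (EuclideanSpace ℝ (Fin d)), S ⊆ D → IsCompact S →
    RelativelyDense {τ : ℝ | ∀ t : ℝ, ∀ x ∈ S, dist (f (t + τ, x)) (f (t, x)) < ε}

/-- An almost periodic function has small increments under small translations. -/
theorem ap_small_shift {d : ℕ} {D : Set (EuclideanSpace ℝ (Fin d))}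
    {f : ℝ × EuclideanSpace ℝ (Fin d) → EuclideanSpace ℝ (Fin d)}
    (hf : ContinuousOn f (Set.univ ×ˢ D)) (hap : IsUniformlyAP D f)
    {ε : ℝ} (hε : 0 < ε) {S : Set (EuclideanSpace ℝ (Fin d))} (hSD : S ⊆ D) (hS : IsCompact S) :
    ∃ δ > 0, ∀ s : ℝ, |s| < δ → ∀ t : ℝ, ∀ x ∈ S, dist (f (t + s, x)) (f (t, x)) < ε := by
  obtain ⟨l, hl, hT⟩ := hap (ε / 3) (by positivity) S hSD hS
  have hK : IsCompact (Set.Icc (-1 : ℝ) (l + 1) ×ˢ S) := isCompact_Icc.prod hS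
  have huc := hK.uniformContinuousOn_of_continuous
    (hf.mono (Set.prod_mono (Set.subset_univ _) hSD))
  rw [Metric.uniformContinuousOn_iff] at huc
  obtain ⟨δ, hδ, H⟩ := huc (ε / 3) (by positivity)
  refine ⟨min δ 1, by positivity, fun s hs t x hx => ?_⟩
  obtain ⟨τ, ⟨h1, h2⟩, hτ⟩ := hT (-t)
  have hsδ : |s| < δ := lt_of_lt_of_le hs (min_le_left _ _)
  have hs1 := abs_lt.1 (lt_of_lt_of_le hs (min_le_right _ _))
  have a1 := hτ (t + s) x hx
  have a2 := hτ t x hx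
  have a3 := H (t + s + τ, x) ⟨⟨by simp only; linarith [hs1.1], by simp only; linarith [hs1.2]⟩, hx⟩
    (t + τ, x) ⟨⟨by simp only; linarith, by simp only; linarith⟩, hx⟩ (by
      rw [Prod.dist_eq]
      simp only [dist_self, Real.dist_eq]
      rw [show t + s + τ - (t + τ) = s by ring]
      exact max_lt hsδ hδ)
  have a4 := dist_triangle4 (f (t + s, x)) (f (t + s + τ, x)) (f (t + τ, x)) (f (t, x))
  rw [dist_comm] at a1
  linarith

/-- The translates of an almost periodic function have finite nets. -/
theorem ap_finite_net {d : ℕ} {D : Set (EuclideanSpace ℝ (Fin d))}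
    {f : ℝ × EuclideanSpace ℝ (Fin d) → EuclideanSpace ℝ (Fin d)}
    (hf : ContinuousOn f (Set.univ ×ˢ D)) (hap : IsUniformlyAP D f)
    {ε : ℝ} (hε : 0 < ε) {S : Set (EuclideanSpace ℝ (Fin d))} (hSD : S ⊆ D) (hS : IsCompact S) :
    ∃ F : Set ℝ, F.Finite ∧ ∀ s : ℝ, ∃ r ∈ F, ∀ t : ℝ, ∀ x ∈ S,
      dist (f (t + s, x)) (f (t + r, x)) < ε := by
  obtain ⟨δ, hδ, hs⟩ := ap_small_shift hf hap (half_pos hε) hSD hS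
  obtain ⟨l, hl, hT⟩ := hap (ε / 2) (half_pos hε) S hSD hS
  have htb : TotallyBounded (Set.Icc (0 : ℝ) l) := isCompact_Icc.totallyBounded
  obtain ⟨F, hF, hcov⟩ := Metric.totallyBounded_iff.1 htb δ hδ
  refine ⟨F, hF, fun s => ?_⟩
  obtain ⟨τ, ⟨h1, h2⟩, hτ⟩ := hT (s - l)
  have hmem : s - τ ∈ Set.Icc (0 : ℝ) l := ⟨by linarith, by linarith⟩
  obtain ⟨r, hr, hb⟩ := Set.mem_iUnion₂.1 (hcov hmem)
  rw [Metric.mem_ball, Real.dist_eq] at hb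
  refine ⟨r, hr, fun t x hx => ?_⟩
  have a1 := hτ (t + s - τ) x hx
  have a2 := hs _ hb (t + r) x hx
  rw [show t + s - τ + τ = t + s by ring] at a1
  rw [show t + r + (s - τ - r) = t + s - τ by ring] at a2
  have := dist_triangle (f (t + s, x)) (f (t + s - τ, x)) (f (t + r, x))
  linarith

/-- Open subsets of Euclidean space are exhausted by compact sets. -/
theorem exists_exhaustion {d : ℕ} (D : Set (EuclideanSpace ℝ (Fin d))) (hD : IsOpen D) :
    ∃ K : ℕ → Set (EuclideanSpace ℝ (Fin d)), (∀ n, K n ⊆ D ∧ IsCompact (K n)) ∧ Monotone K ∧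
      ∀ S, S ⊆ D → IsCompact S → ∃ n, S ⊆ K n := by
  have : LocallyCompactSpace D := hD.locallyCompactSpace
  let K : CompactExhaustion D := default
  refine ⟨fun n => Subtype.val '' K n, fun n => ⟨?_, ?_⟩, ?_, ?_⟩
  · rintro _ ⟨x, -, rfl⟩
    exact x.2
  · exact (K.isCompact n).image continuous_subtype_val
  · intro m n hmn
    exact Set.image_mono (K.subset hmn)
  · intro S hSD hS
    have hc : IsCompact (Subtype.val ⁻¹' S : Set D) := by
      rw [Subtype.isCompact_iff, Subtype.image_preimage_coe, Set.inter_eq_right.2 hSD]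
      exact hS
    obtain ⟨n, hn⟩ := K.exists_superset_of_isCompact hc
    exact ⟨n, fun x hx => ⟨⟨x, hSD hx⟩, hn hx, rfl⟩⟩

/-- Bochner's normality property of almost periodic functions. -/
theorem ap_normal {d : ℕ} {D : Set (EuclideanSpace ℝ (Fin d))} (hD : IsOpen D)
    {f : ℝ × EuclideanSpace ℝ (Fin d) → EuclideanSpace ℝ (Fin d)}
    (hf : ContinuousOn f (Set.univ ×ˢ D)) (hap : IsUniformlyAP D f) (γ : ℕ → ℝ) :
    ∃ φ : ℕ → ℕ, StrictMono φ ∧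
      ∃ g : ℝ × EuclideanSpace ℝ (Fin d) → EuclideanSpace ℝ (Fin d),
        ∀ S : Set (EuclideanSpace ℝ (Fin d)), S ⊆ D → IsCompact S →
          TendstoUniformlyOn (fun k p => f (p.1 + γ (φ k), p.2)) g atTop (Set.univ ×ˢ S) := by
  obtain ⟨K, hK, hKm, hKe⟩ := exists_exhaustion D hD
  let 𝔖 : Set (Set (ℝ × EuclideanSpace ℝ (Fin d))) :=
    {A | ∃ S, S ⊆ D ∧ IsCompact S ∧ A = Set.univ ×ˢ S}
  let t : ℕ → Set (ℝ × EuclideanSpace ℝ (Fin d)) := fun n => Set.univ ×ˢ K n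
  have ht : ∀ n, t n ∈ 𝔖 := fun n => ⟨K n, (hK n).1, (hK n).2, rfl⟩
  have htm : Monotone t := fun m n h => Set.prod_mono subset_rfl (hKm h)
  have hte : ∀ s ∈ 𝔖, ∃ n, s ⊆ t n := by
    rintro _ ⟨S, hS, hSc, rfl⟩
    obtain ⟨n, hn⟩ := hKe S hS hSc
    exact ⟨n, Set.prod_mono subset_rfl hn⟩
  have hne : 𝔖.Nonempty := ⟨_, ht 0⟩
  have hdir : DirectedOn (· ⊆ ·) 𝔖 := by
    intro a ha b hb
    obtain ⟨m, hm⟩ := hte a ha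
    obtain ⟨n, hn⟩ := hte b hb
    exact ⟨t (max m n), ht _, hm.trans (htm (le_max_left _ _)), hn.trans (htm (le_max_right _ _))⟩
  have : IsCountablyGenerated
      (uniformity (UniformOnFun (ℝ × EuclideanSpace ℝ (Fin d)) (EuclideanSpace ℝ (Fin d)) 𝔖)) :=
    UniformOnFun.isCountablyGenerated_uniformity 𝔖 ht htm hte
  let Φ : ℝ → (UniformOnFun (ℝ × EuclideanSpace ℝ (Fin d)) (EuclideanSpace ℝ (Fin d)) 𝔖) :=
    fun r => UniformOnFun.ofFun 𝔖 (fun p => f (p.1 + r, p.2))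
  have htb : TotallyBounded (Set.range Φ) := by
    intro V hV
    obtain ⟨⟨A, ε⟩, ⟨hA, hε⟩, hsub⟩ := (UniformOnFun.hasBasis_uniformity_of_basis _ _ 𝔖 hne hdir
      Metric.uniformity_basis_dist).mem_iff.1 hV
    obtain ⟨S, hSD, hS, rfl⟩ := hA
    obtain ⟨F, hF, hcov⟩ := ap_finite_net hf hap hε hSD hS
    refine ⟨Φ '' F, hF.image _, ?_⟩
    rintro _ ⟨s, rfl⟩
    obtain ⟨r, hr, h⟩ := hcov s
    refine Set.mem_iUnion₂.2 ⟨Φ r, ⟨r, hr, rfl⟩, hsub ?_⟩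
    rintro ⟨u, x⟩ ⟨-, hx⟩
    exact h u x hx
  have hcomp : IsCompact (closure (Set.range Φ)) :=
    htb.closure.isCompact_of_isClosed isClosed_closure
  obtain ⟨G, -, φ, hφ, hlim⟩ := hcomp.isSeqCompact
    (x := fun n => Φ (γ n)) (fun n => subset_closure ⟨γ n, rfl⟩)
  refine ⟨φ, hφ, UniformOnFun.toFun 𝔖 G, fun S hSD hS => ?_⟩
  exact UniformOnFun.tendsto_iff_tendstoUniformlyOn.1 hlim _ ⟨S, hSD, hS, rfl⟩

/-- Bochner's double-sequence criterion for uniform almost periodicity: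
`f` is almost periodic in `t` uniformly for `x ∈ D` iff for all sequences `α'`, `β'`
there are common subsequences (along the same index sequence `φ`) such that
`T_{α+β} f = T_α T_β f` uniformly on `ℝ × S` for every compact `S ⊆ D`. -/
theorem uniformlyAP_iff_double_seq {d : ℕ}
    (D : Set (EuclideanSpace ℝ (Fin d))) (hD : IsOpen D)
    (f : ℝ × EuclideanSpace ℝ (Fin d) → EuclideanSpace ℝ (Fin d))
    (hf : ContinuousOn f (Set.univ ×ˢ D)) :
    IsUniformlyAP D f ↔
      ∀ α' β' : ℕ → ℝ, ∃ φ : ℕ → ℕ, StrictMono φ ∧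
        ∃ h g : ℝ × EuclideanSpace ℝ (Fin d) → EuclideanSpace ℝ (Fin d),
          ∀ S : Set (EuclideanSpace ℝ (Fin d)), S ⊆ D → IsCompact S →
            TendstoUniformlyOn (fun k p => f (p.1 + (α' (φ k) + β' (φ k)), p.2)) h atTop
              (Set.univ ×ˢ S) ∧
            TendstoUniformlyOn (fun k p => f (p.1 + β' (φ k), p.2)) g atTop
              (Set.univ ×ˢ S) ∧
            TendstoUniformlyOn (fun k p => g (p.1 + α' (φ k), p.2)) h atTop
              (Set.univ ×ˢ S) := by
  constructor
  · intro hap α' β'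
    obtain ⟨φ, hφ, g, hg⟩ := ap_normal hD hf hap β'
    obtain ⟨ψ, hψ, h, hh⟩ := ap_normal hD hf hap (fun n => α' (φ n) + β' (φ n))
    refine ⟨φ ∘ ψ, hφ.comp hψ, h, g, fun S hSD hS => ?_⟩
    have H1 := hh S hSD hS
    have H2 : TendstoUniformlyOn (fun k p => f (p.1 + β' ((φ ∘ ψ) k), p.2)) g atTop
        (Set.univ ×ˢ S) := fun u hu => hψ.tendsto_atTop.eventually (hg S hSD hS u hu)
    refine ⟨H1, H2, ?_⟩
    rw [Metric.tendstoUniformlyOn_iff] at H1 H2 ⊢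
    intro ε hε
    filter_upwards [H1 (ε / 2) (half_pos hε), H2 (ε / 2) (half_pos hε)] with k h1 h2 p hp
    have a1 := h1 p hp
    have a2 := h2 (p.1 + α' ((φ ∘ ψ) k), p.2) ⟨Set.mem_univ _, hp.2⟩
    simp only [Function.comp_apply] at a1 a2 ⊢
    rw [add_assoc, dist_comm] at a2
    have := dist_triangle (h p) (f (p.1 + (α' (φ (ψ k)) + β' (φ (ψ k))), p.2))
      (g (p.1 + α' (φ (ψ k)), p.2))
    linarith
  · intro H ε hε S hSD hS
    by_contra hnd
    set T : Set ℝ := {τ : ℝ | ∀ t : ℝ, ∀ x ∈ S, dist (f (t + τ, x)) (f (t, x)) < ε} with hTdef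
    have hnd' : ∀ l > 0, ∃ a : ℝ, ∀ τ ∈ Set.Ioo a (a + l), τ ∉ T := by
      intro l hl
      by_contra hc
      push Not at hc
      exact hnd ⟨l, hl, hc⟩
    obtain ⟨β, -, hβ⟩ := exists_seq_of_forall_finset_exists (fun _ : ℝ => True)
      (fun x y => y - x ∉ T) (by
        intro F _
        have hM : ∃ M > 0, ∀ x ∈ F, |x| < M := by
          refine ⟨∑ x ∈ F, |x| + 1, ?_, fun x hx => ?_⟩
          · have := Finset.sum_nonneg (fun x (_ : x ∈ F) => abs_nonneg x)
            linarith
          · have := Finset.single_le_sum (fun x (_ : x ∈ F) => abs_nonneg x) hx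
            linarith
        obtain ⟨M, hM0, hM⟩ := hM
        obtain ⟨a, ha⟩ := hnd' (2 * M) (by linarith)
        refine ⟨a + M, trivial, fun x hx => ha _ ?_⟩
        have := abs_lt.1 (hM x hx)
        exact ⟨by linarith, by linarith⟩)
    obtain ⟨φ, hφ, h, g, hg⟩ := H (fun _ => 0) β
    have H2 := (hg S hSD hS).2.1
    rw [Metric.tendstoUniformlyOn_iff] at H2
    obtain ⟨N, hN⟩ := eventually_atTop.1 (H2 (ε / 2) (half_pos hε))
    refine hβ (φ N) (φ (N + 1)) (hφ (Nat.lt_succ_self N)) fun t x hx => ?_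
    have a1 := hN N le_rfl (t - β (φ N), x) ⟨Set.mem_univ _, hx⟩
    have a2 := hN (N + 1) (Nat.le_succ N) (t - β (φ N), x) ⟨Set.mem_univ _, hx⟩
    simp only at a1 a2
    rw [sub_add_cancel] at a1
    rw [show t - β (φ N) + β (φ (N + 1)) = t + (β (φ (N + 1)) - β (φ N)) by ring] at a2
    have := dist_triangle_left (f (t + (β (φ (N + 1)) - β (φ N)), x)) (f (t, x))
      (g (t - β (φ N), x))
    linarith
end

section
/- Let (M,d) be a complete metric space and f : ℝ₊ → M be continuous. Then f is asymptotically almost periodic if and only if the following holds: for every sequence (α'_n) of positive reals with α'_n → +∞ there exist a subsequence α = (α_n) of (α'_n) and a constant d(α) > 0 such that T_α f exists pointwise on ℝ₊, and whenever sequences δ = (δ_n) of positive reals, β ⊆ α and γ ⊆ α are such that h₁(t) := lim_{n→∞} f(t + δ_n + β_n) and h₂(t) := lim_{n→∞} f(t + δ_n + γ_n) exist pointwise on ℝ₊, then either h₁(t) = h₂(t) for all t ∈ ℝ₊, or inf_{t ∈ ℝ₊} d(h₁(t), h₂(t)) ≥ 2·d(α). -/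
open Filter Topology Set

/-- Bohr almost periodic continuous functions are uniformly continuous. -/
theorem bohr_uc {M : Type*} [MetricSpace M] {p : ℝ → M} (hc : Continuous p)
    (hp : IsBohrAP p) : UniformContinuous p := by
  rw [Metric.uniformContinuous_iff]
  intro ε hε
  obtain ⟨l, hl, H⟩ := hp (ε / 3) (by positivity)
  have hK : UniformContinuousOn p (Icc (-1) (l + 1)) :=
    isCompact_Icc.uniformContinuousOn_of_continuous hc.continuousOn
  rw [Metric.uniformContinuousOn_iff] at hK
  obtain ⟨δ, hδ, hK⟩ := hK (ε / 3) (by positivity)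
  refine ⟨min δ 1, by positivity, ?_⟩
  intro a b hab
  obtain ⟨τ, ⟨h1, h2⟩, hτ⟩ := H (-a)
  have hab1 : |a - b| < δ := lt_of_lt_of_le hab (min_le_left _ _)
  have hab2 : |a - b| < 1 := lt_of_lt_of_le hab (min_le_right _ _)
  have hab3 := abs_lt.1 hab2
  have e := hK (a + τ) ⟨by linarith, by linarith⟩ (b + τ)
    ⟨by linarith, by linarith⟩ (by rw [Real.dist_eq]; simpa using hab1)
  have e1 := hτ a
  have e2 := hτ b
  have e3 := dist_triangle4 (p a) (p (a + τ)) (p (b + τ)) (p b)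
  rw [dist_comm (p a) (p (a + τ))] at e3
  linarith

/-- Bochner: from every sequence extract one along which translates are uniformly Cauchy. -/
theorem bohr_bochner {M : Type*} [MetricSpace M] [CompleteSpace M] {p : ℝ → M}
    (hc : Continuous p) (hp : IsBohrAP p) (α : ℕ → ℝ) :
    ∃ φ : ℕ → ℕ, StrictMono φ ∧ ∃ g : ℝ → M, ∀ ε > 0, ∃ n0, ∀ n ≥ n0, ∀ t,
      dist (p (t + α (φ n))) (g t) < ε := by
  have huc := bohr_uc hc hp
  have hb : ∃ C, ∀ x y, dist (p x) (p y) ≤ C := by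
    obtain ⟨l, hl, H⟩ := hp 1 one_pos
    have hK : Bornology.IsBounded (p '' Icc 0 l) := (isCompact_Icc.image hc).isBounded
    obtain ⟨C, hC⟩ := Metric.isBounded_iff.1 hK
    refine ⟨C + 2, fun x y => ?_⟩
    obtain ⟨τ, ⟨h1, h2⟩, hτ⟩ := H (-x)
    obtain ⟨σ, ⟨h3, h4⟩, hσ⟩ := H (-y)
    have e := hC (mem_image_of_mem p (show x + τ ∈ Icc 0 l from ⟨by linarith, by linarith⟩))
      (mem_image_of_mem p (show y + σ ∈ Icc 0 l from ⟨by linarith, by linarith⟩))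
    have e1 := hτ x
    have e2 := hσ y
    have e3 := dist_triangle4 (p x) (p (x + τ)) (p (y + σ)) (p y)
    rw [dist_comm (p x) (p (x + τ))] at e3
    linarith
  obtain ⟨C, hC⟩ := hb
  let F : ℝ → BoundedContinuousFunction ℝ M := fun s =>
    BoundedContinuousFunction.mkOfBound ⟨fun t => p (t + s), by fun_prop⟩ C
      (fun x y => hC _ _)
  have hFe : ∀ s t, F s t = p (t + s) := fun s t => rfl
  have hFc : Continuous F := by
    rw [Metric.continuous_iff]
    intro b ε hε
    obtain ⟨δ, hδ, h⟩ := Metric.uniformContinuous_iff.1 huc (ε / 2) (by positivity)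
    refine ⟨δ, hδ, fun a ha => ?_⟩
    refine lt_of_le_of_lt ((BoundedContinuousFunction.dist_le (by positivity)).2 fun t => ?_)
      (half_lt_self hε)
    rw [hFe, hFe]
    refine (h ?_).le
    simpa using ha
  have htb : TotallyBounded (range F) := by
    rw [Metric.totallyBounded_iff]
    intro ε hε
    obtain ⟨l, hl, H⟩ := hp (ε / 3) (by positivity)
    have hK : TotallyBounded (F '' Icc 0 l) := (isCompact_Icc.image hFc).totallyBounded
    obtain ⟨T, hT, hcov⟩ := Metric.totallyBounded_iff.1 hK (ε / 2) (by positivity)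
    refine ⟨T, hT, ?_⟩
    rintro _ ⟨s, rfl⟩
    obtain ⟨τ, ⟨h1, h2⟩, hτ⟩ := H (-s)
    have hm := hcov (mem_image_of_mem F (show s + τ ∈ Icc 0 l from ⟨by linarith, by linarith⟩))
    simp only [mem_iUnion, Metric.mem_ball] at hm ⊢
    obtain ⟨y, hy, hd⟩ := hm
    refine ⟨y, hy, ?_⟩
    have : dist (F s) (F (s + τ)) ≤ ε / 3 := by
      refine (BoundedContinuousFunction.dist_le (by positivity)).2 fun t => ?_
      rw [hFe, hFe, dist_comm, ← add_assoc]
      exact (hτ _).le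
    have := dist_triangle (F s) (F (s + τ)) y
    linarith
  have hcpt : IsCompact (closure (range F)) :=
    htb.closure.isCompact_of_isClosed isClosed_closure
  obtain ⟨g, -, φ, hφ, hlim⟩ := hcpt.tendsto_subseq
    (fun n => subset_closure (mem_range_self (f := F) (α n)))
  refine ⟨φ, hφ, g, fun ε hε => ?_⟩
  obtain ⟨n0, h⟩ := Metric.tendsto_atTop.1 hlim ε hε
  refine ⟨n0, fun n hn t => ?_⟩
  exact lt_of_le_of_lt (BoundedContinuousFunction.dist_coe_le_dist (f := F (α (φ n))) t) (h n hn)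

/-- The forward direction. -/
theorem fwd_dir {M : Type*} [MetricSpace M] [CompleteSpace M]
    (f p : ℝ → M) (hc : Continuous p) (hp : IsBohrAP p)
    (hfp : Tendsto (fun t => dist (f t) (p t)) atTop (nhds 0))
    (α' : ℕ → ℝ) (hα : Tendsto α' atTop atTop) :
        ∃ φ : ℕ → ℕ, StrictMono φ ∧
          (∃ g : ℝ → M, ∀ t ≥ (0 : ℝ),
            Tendsto (fun n => f (t + α' (φ n))) atTop (nhds (g t))) ∧
          ∀ (δ : ℕ → ℝ) (ψ χ : ℕ → ℕ) (h₁ h₂ : ℝ → M),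
            (∀ n, 0 < δ n) → StrictMono ψ → StrictMono χ →
            (∀ t ≥ (0 : ℝ),
              Tendsto (fun n => f (t + (δ n + α' (φ (ψ n))))) atTop (nhds (h₁ t))) →
            (∀ t ≥ (0 : ℝ),
              Tendsto (fun n => f (t + (δ n + α' (φ (χ n))))) atTop (nhds (h₂ t))) →
            (∀ t ≥ (0 : ℝ), h₁ t = h₂ t) := by
  obtain ⟨φ, hφ, g, hg⟩ := bohr_bochner hc hp α'
  have hαφ : Tendsto (fun n => α' (φ n)) atTop atTop := hα.comp hφ.tendsto_atTop
  refine ⟨φ, hφ, ⟨g, fun t ht => ?_⟩, ?_⟩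
  · rw [tendsto_iff_dist_tendsto_zero]
    have h1 : Tendsto (fun n => dist (f (t + α' (φ n))) (p (t + α' (φ n)))) atTop (nhds 0) :=
      hfp.comp (tendsto_atTop_add_const_left _ t hαφ)
    have h2 : Tendsto (fun n => dist (p (t + α' (φ n))) (g t)) atTop (nhds 0) := by
      rw [← tendsto_iff_dist_tendsto_zero, Metric.tendsto_atTop]
      intro ε hε
      obtain ⟨n0, h⟩ := hg ε hε
      exact ⟨n0, fun n hn => h n hn t⟩
    have h3 := h1.add h2
    rw [add_zero] at h3
    exact squeeze_zero (fun _ => dist_nonneg) (fun n => dist_triangle _ _ _) h3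
  · intro δ ψ χ h₁ h₂ hδ hψ hχ H1 H2 t ht
    have hx : ∀ ψ : ℕ → ℕ, StrictMono ψ →
        Tendsto (fun n => t + (δ n + α' (φ (ψ n)))) atTop atTop := by
      intro ψ hψ
      refine tendsto_atTop_mono (fun n => ?_) (hαφ.comp hψ.tendsto_atTop)
      have := hδ n
      simp only [Function.comp]
      linarith
    have d1 := hfp.comp (hx ψ hψ)
    have d2 := hfp.comp (hx χ hχ)
    have d3 : Tendsto (fun n => dist (p (t + (δ n + α' (φ (ψ n)))))
        (p (t + (δ n + α' (φ (χ n)))))) atTop (nhds 0) := by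
      rw [Metric.tendsto_atTop]
      intro ε hε
      obtain ⟨n0, h⟩ := hg (ε / 2) (by positivity)
      refine ⟨n0, fun n hn => ?_⟩
      have e1 := h (ψ n) (hn.le.trans hψ.le_apply) (t + δ n)
      have e2 := h (χ n) (hn.le.trans hχ.le_apply) (t + δ n)
      rw [← add_assoc, ← add_assoc, Real.dist_eq, sub_zero, abs_of_nonneg dist_nonneg]
      have := dist_triangle_right (p (t + δ n + α' (φ (ψ n)))) (p (t + δ n + α' (φ (χ n))))
        (g (t + δ n))
      linarith
    have d4 := (d1.add d3).add d2
    simp only [add_zero] at d4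
    have d5 := (H1 t ht).dist (H2 t ht)
    have d6 : Tendsto (fun n => dist (f (t + (δ n + α' (φ (ψ n)))))
        (f (t + (δ n + α' (φ (χ n)))))) atTop (nhds 0) := by
      refine squeeze_zero (fun _ => dist_nonneg) (fun n => ?_) d4
      have := dist_triangle4 (f (t + (δ n + α' (φ (ψ n))))) (p (t + (δ n + α' (φ (ψ n)))))
        (p (t + (δ n + α' (φ (χ n))))) (f (t + (δ n + α' (φ (χ n)))))
      rw [dist_comm (p (t + (δ n + α' (φ (χ n)))))] at this
      exact this
    exact dist_eq_zero.1 (tendsto_nhds_unique d5 d6)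

/-- Separation implies uniform Cauchy translates. -/
theorem sep_uniform {M : Type*} [MetricSpace M]
    (f : ℝ → M) (hf : ContinuousOn f (Set.Ici (0 : ℝ)))
    (H : ∀ α' : ℕ → ℝ, (∀ n, 0 < α' n) → Tendsto α' atTop atTop →
        ∃ φ : ℕ → ℕ, StrictMono φ ∧ ∃ dα > (0 : ℝ),
          (∃ g : ℝ → M, ∀ t ≥ (0 : ℝ),
            Tendsto (fun n => f (t + α' (φ n))) atTop (nhds (g t))) ∧
          ∀ (δ : ℕ → ℝ) (ψ χ : ℕ → ℕ) (h₁ h₂ : ℝ → M),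
            (∀ n, 0 < δ n) → StrictMono ψ → StrictMono χ →
            (∀ t ≥ (0 : ℝ),
              Tendsto (fun n => f (t + (δ n + α' (φ (ψ n))))) atTop (nhds (h₁ t))) →
            (∀ t ≥ (0 : ℝ),
              Tendsto (fun n => f (t + (δ n + α' (φ (χ n))))) atTop (nhds (h₂ t))) →
            (∀ t ≥ (0 : ℝ), h₁ t = h₂ t) ∨
              (∀ t ≥ (0 : ℝ), 2 * dα ≤ dist (h₁ t) (h₂ t)))
    (α' : ℕ → ℝ) (hpos : ∀ n, 0 < α' n) (hα : Tendsto α' atTop atTop) :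
    ∃ φ : ℕ → ℕ, StrictMono φ ∧ ∀ ε > 0, ∃ n0, ∀ n ≥ n0, ∀ m ≥ n0, ∀ t ≥ (0 : ℝ),
      dist (f (t + α' (φ n))) (f (t + α' (φ m))) ≤ ε := by
  obtain ⟨φ, hφ, dα, hd, ⟨g, hg⟩, hsep⟩ := H α' hpos hα
  refine ⟨φ, hφ, ?_⟩
  by_contra! hcon
  obtain ⟨ε, hε, hcon⟩ := hcon
  set c := min ε dα with hc
  have hc0 : 0 < c := lt_min hε hd
  have hαφ : Tendsto (fun n => α' (φ n)) atTop atTop := hα.comp hφ.tendsto_atTop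
  have key : ∀ k : ℕ, ∃ n m : ℕ, ∃ t : ℝ, k ≤ n ∧ k ≤ m ∧ 0 < t ∧
      dist (f (t + α' (φ n))) (f (t + α' (φ m))) = c := by
    intro k
    obtain ⟨n1, hn1⟩ := Metric.tendsto_atTop.1 (hg 0 le_rfl) (c / 2) (by positivity)
    obtain ⟨n, hn, m, hm, t, ht, hlt⟩ := hcon (max k n1)
    have e1 := hn1 n ((le_max_right _ _).trans hn)
    have e2 := hn1 m ((le_max_right _ _).trans hm)
    have e3 := dist_triangle_right (f (0 + α' (φ n))) (f (0 + α' (φ m))) (g 0)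
    have hcont : ContinuousOn (fun t => dist (f (t + α' (φ n))) (f (t + α' (φ m)))) (Icc 0 t) := by
      have q : ∀ j, ContinuousOn (fun t => f (t + α' (φ j))) (Icc 0 t) := by
        intro j
        refine hf.comp (by fun_prop) ?_
        intro s hs
        have := hpos (φ j)
        exact mem_Ici.2 (by linarith [hs.1])
      exact fun s hs => Filter.Tendsto.dist (q n s hs) (q m s hs)
    have hiv := intermediate_value_Icc ht hcont
    have hcm : c ∈ Icc (dist (f (0 + α' (φ n))) (f (0 + α' (φ m))))
        (dist (f (t + α' (φ n))) (f (t + α' (φ m)))) :=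
      ⟨by linarith, (min_le_left _ _).trans hlt.le⟩
    obtain ⟨s, hs, hsc⟩ := hiv hcm
    refine ⟨n, m, s, (le_max_left _ _).trans hn, (le_max_left _ _).trans hm, ?_, hsc⟩
    rcases hs.1.eq_or_lt with h0 | h0
    · subst h0
      simp only at hsc
      linarith
    · exact h0
  choose N K δ hN hK hδ hdist using key
  have hNt : Tendsto N atTop atTop := tendsto_atTop_mono hN tendsto_id
  have hKt : Tendsto K atTop atTop := tendsto_atTop_mono hK tendsto_id
  obtain ⟨k1, hk1, hNk1⟩ := strictMono_subseq_of_tendsto_atTop hNt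
  obtain ⟨k2, hk2, hKk2⟩ := strictMono_subseq_of_tendsto_atTop (hKt.comp hk1.tendsto_atTop)
  have conv : ∀ L k : ℕ → ℕ, Tendsto L atTop atTop → StrictMono k → ∃ r : ℕ → ℕ, StrictMono r ∧
      ∃ h : ℝ → M, ∀ t ≥ (0 : ℝ),
        Tendsto (fun n => f (t + (δ (k (r n)) + α' (φ (L (k (r n))))))) atTop (nhds (h t)) := by
    intro L k hL hk
    obtain ⟨r, hr, _, _, hh, _⟩ := H (fun n => δ (k n) + α' (φ (L (k n))))
      (fun n => add_pos (hδ _) (hpos _))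
      (tendsto_atTop_mono (fun n => (by
        have := hδ (k n)
        simp only [Function.comp]
        linarith)) ((hαφ.comp hL).comp hk.tendsto_atTop))
    exact ⟨r, hr, hh⟩
  obtain ⟨r1, hr1, h₁, hh1⟩ := conv N (k1 ∘ k2) hNt (hk1.comp hk2)
  obtain ⟨r2, hr2, h₂, hh2⟩ := conv K ((k1 ∘ k2) ∘ r1) hKt ((hk1.comp hk2).comp hr1)
  have hh1' : ∀ t ≥ (0 : ℝ), Tendsto (fun n => f (t + (δ (k1 (k2 (r1 (r2 n)))) +
      α' (φ (N (k1 (k2 (r1 (r2 n)))))))))  atTop (nhds (h₁ t)) :=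
    fun t ht => (hh1 t ht).comp hr2.tendsto_atTop
  have hfin := hsep (fun n => δ (k1 (k2 (r1 (r2 n))))) (fun n => N (k1 (k2 (r1 (r2 n)))))
    (fun n => K (k1 (k2 (r1 (r2 n))))) h₁ h₂ (fun n => hδ _)
    (hNk1.comp (hk2.comp (hr1.comp hr2))) (hKk2.comp (hr1.comp hr2)) hh1' hh2
  have hlim := (hh1' 0 le_rfl).dist (hh2 0 le_rfl)
  have hceq : dist (h₁ 0) (h₂ 0) = c := by
    refine tendsto_nhds_unique hlim ?_
    refine tendsto_const_nhds.congr (fun n => ?_)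
    rw [zero_add, zero_add]
    exact (hdist _).symm
  rcases hfin with h | h
  · rw [h 0 le_rfl, dist_self] at hceq
    linarith
  · have := h 0 le_rfl
    have : c ≤ dα := min_le_right _ _
    linarith

/-- Asymptotic `ε`-periods are relatively dense in the half line. -/
theorem good_dense {M : Type*} [MetricSpace M] (f : ℝ → M)
    (F : ∀ α' : ℕ → ℝ, (∀ n, 0 < α' n) → Tendsto α' atTop atTop →
      ∃ φ : ℕ → ℕ, StrictMono φ ∧ ∀ ε > 0, ∃ n0, ∀ n ≥ n0, ∀ m ≥ n0, ∀ t ≥ (0 : ℝ),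
      dist (f (t + α' (φ n))) (f (t + α' (φ m))) ≤ ε)
    (ε : ℝ) (hε : 0 < ε) :
    ∃ l > 0, ∀ a ≥ (0 : ℝ), ∃ τ ∈ Ioo a (a + l), ∃ T, ∀ t ≥ T, dist (f (t + τ)) (f t) ≤ ε := by
  by_contra hcon
  have hbad : ∀ l : ℝ, ∃ a ≥ (0 : ℝ), 0 < l → ∀ τ ∈ Ioo a (a + l),
      ¬ ∃ T, ∀ t ≥ T, dist (f (t + τ)) (f t) ≤ ε := by
    intro l
    by_contra! h
    refine hcon ⟨l, (h 0 le_rfl).1, fun a ha => ?_⟩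
    obtain ⟨-, τ, h1, h2⟩ := h a ha
    exact ⟨τ, h1, h2⟩
  choose a ha hbad using hbad
  let b : ℕ → ℝ := fun n => Nat.rec 1 (fun _ x => a (x + 1) + x + 1) n
  have hb0 : b 0 = 1 := rfl
  have hbs : ∀ n, b (n + 1) = a (b n + 1) + b n + 1 := fun n => rfl
  have hbge : ∀ n : ℕ, (n : ℝ) + 1 ≤ b n := by
    intro n
    induction n with
    | zero => simp [hb0]
    | succ k ih =>
      have := ha (b k + 1)
      rw [hbs]
      push_cast
      linarith
  have hbm : Monotone b := monotone_nat_of_le_succ fun n => by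
    have := ha (b n + 1)
    rw [hbs]
    linarith
  have hbpos : ∀ n, 0 < b n := fun n => by
    have h1 := hbge n
    have h2 : (0 : ℝ) ≤ n := Nat.cast_nonneg n
    linarith
  have hbt : Tendsto b atTop atTop :=
    tendsto_atTop_mono (fun n => (by linarith [hbge n] : (n : ℝ) ≤ b n))
      tendsto_natCast_atTop_atTop
  obtain ⟨φ, hφ, hF⟩ := F b hbpos hbt
  obtain ⟨n0, hn0⟩ := hF ε hε
  have hlt : φ n0 < φ (n0 + 1) := hφ (Nat.lt_succ_self _)
  obtain ⟨m, hm⟩ : ∃ m, φ (n0 + 1) = m + 1 := ⟨φ (n0 + 1) - 1, by omega⟩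
  have hle : b (φ n0) ≤ b m := hbm (by omega)
  have hp0 := hbpos (φ n0)
  have hpm := hbpos m
  refine hbad (b m + 1) (by linarith) (b (m + 1) - b (φ n0)) ⟨?_, ?_⟩ ⟨b (φ n0), fun t ht => ?_⟩
  · rw [hbs]; linarith
  · rw [hbs]; linarith
  · have := hn0 (n0 + 1) (Nat.le_succ _) n0 le_rfl (t - b (φ n0)) (by linarith)
    rw [hm, sub_add_cancel] at this
    convert this using 3
    ring

/-- The backward direction from uniform Cauchy translates. -/
theorem bwd_dir {M : Type*} [MetricSpace M] [CompleteSpace M] (f : ℝ → M)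
    (hf : ContinuousOn f (Set.Ici (0 : ℝ)))
    (F : ∀ α' : ℕ → ℝ, (∀ n, 0 < α' n) → Tendsto α' atTop atTop →
      ∃ φ : ℕ → ℕ, StrictMono φ ∧ ∀ ε > 0, ∃ n0, ∀ n ≥ n0, ∀ m ≥ n0, ∀ t ≥ (0 : ℝ),
      dist (f (t + α' (φ n))) (f (t + α' (φ m))) ≤ ε) :
    ∃ p : ℝ → M, Continuous p ∧ IsBohrAP p ∧
        Tendsto (fun t => dist (f t) (p t)) atTop (nhds 0) := by
  have G := good_dense f F
  have hex : ∀ n : ℕ, ∃ τ : ℝ, (n : ℝ) < τ ∧ ∃ T, ∀ t ≥ T,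
      dist (f (t + τ)) (f t) ≤ 1 / ((n : ℝ) + 1) := by
    intro n
    obtain ⟨l, hl, h⟩ := G (1 / ((n : ℝ) + 1)) (by positivity)
    obtain ⟨τ, h1, h2⟩ := h n (by positivity)
    exact ⟨τ, h1.1, h2⟩
  choose σ hσ1 hσ2 using hex
  have hσt : Tendsto σ atTop atTop :=
    tendsto_atTop_mono (fun n => (hσ1 n).le) tendsto_natCast_atTop_atTop
  obtain ⟨φ, hφ, hF⟩ := F σ (fun n => lt_of_le_of_lt (Nat.cast_nonneg n) (hσ1 n)) hσt
  set τ : ℕ → ℝ := fun n => σ (φ n) with hτdef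
  have hτt : Tendsto τ atTop atTop := hσt.comp hφ.tendsto_atTop
  have hper : ∀ ε > 0, ∀ n1 : ℕ, ∃ n ≥ n1, ∃ T, ∀ t ≥ T, dist (f (t + τ n)) (f t) ≤ ε := by
    intro ε hε n1
    obtain ⟨k, hk⟩ := exists_nat_one_div_lt hε
    obtain ⟨T, hT⟩ := hσ2 (φ (max n1 k))
    refine ⟨max n1 k, le_max_left _ _, T, fun t ht => (hT t ht).trans (le_trans ?_ hk.le)⟩
    have : (k : ℝ) ≤ (φ (max n1 k) : ℝ) := by
      exact_mod_cast (le_max_right n1 k).trans hφ.le_apply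
    gcongr
  -- uniformly Cauchy on every half line
  have hUC : ∀ A : ℝ, ∀ ε > 0, ∃ n0, ∀ n ≥ n0, ∀ m ≥ n0, ∀ t ≥ A,
      dist (f (t + τ n)) (f (t + τ m)) ≤ ε := by
    intro A ε hε
    obtain ⟨l, hl, h⟩ := G (ε / 3) (by positivity)
    obtain ⟨ρ, h1, T, hT⟩ := h |A| (abs_nonneg _)
    have hρ : -A ≤ ρ := (neg_le_abs A).trans h1.1.le
    obtain ⟨n0, hn0⟩ := hF (ε / 3) (by positivity)
    obtain ⟨n1, hn1⟩ := eventually_atTop.1 (hτt.eventually_ge_atTop (T - A))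
    refine ⟨max n0 n1, fun n hn m hm t ht => ?_⟩
    have a1 := hT (t + τ n) (by linarith [hn1 n ((le_max_right _ _).trans hn)])
    have a2 := hT (t + τ m) (by linarith [hn1 m ((le_max_right _ _).trans hm)])
    have a3 : dist (f (t + ρ + τ n)) (f (t + ρ + τ m)) ≤ ε / 3 :=
      hn0 n ((le_max_left _ _).trans hn) m ((le_max_left _ _).trans hm)
      (t + ρ) (by linarith)
    rw [add_right_comm] at a1 a2
    have a4 := dist_triangle4 (f (t + τ n)) (f (t + ρ + τ n)) (f (t + ρ + τ m)) (f (t + τ m))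
    rw [dist_comm (f (t + τ n)) (f (t + ρ + τ n))] at a4
    linarith
  have hlim : ∀ t : ℝ, ∃ x, Tendsto (fun n => f (t + τ n)) atTop (nhds x) := by
    intro t
    apply cauchySeq_tendsto_of_complete
    rw [Metric.cauchySeq_iff]
    intro ε hε
    obtain ⟨n0, hn0⟩ := hUC t (ε / 2) (by positivity)
    exact ⟨n0, fun m hm n hn => lt_of_le_of_lt (hn0 m hm n hn t le_rfl) (half_lt_self hε)⟩
  choose p hp using hlim
  have hU : ∀ A : ℝ, ∀ ε > 0, ∃ n0, ∀ n ≥ n0, ∀ t ≥ A, dist (f (t + τ n)) (p t) ≤ ε := by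
    intro A ε hε
    obtain ⟨n0, hn0⟩ := hUC A ε hε
    refine ⟨n0, fun n hn t ht => ?_⟩
    refine le_of_tendsto (tendsto_const_nhds.dist (hp t)) ?_
    filter_upwards [eventually_ge_atTop n0] with m hm
    exact hn0 n hn m hm t ht
  refine ⟨p, ?_, ?_, ?_⟩
  · rw [Metric.continuous_iff]
    intro x ε hε
    obtain ⟨n0, hn0⟩ := hU (x - 1) (ε / 4) (by positivity)
    obtain ⟨n1, hn1⟩ := eventually_atTop.1 (hτt.eventually_ge_atTop (1 - x))
    set n := max n0 n1
    have hn := hn0 n (le_max_left _ _)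
    have hτn : 1 - x ≤ τ n := hn1 n (le_max_right _ _)
    have hfc : ContinuousAt f (x + τ n) :=
      hf.continuousAt (Ici_mem_nhds (by linarith))
    obtain ⟨δ, hδ, hδ'⟩ := Metric.continuousAt_iff.1 hfc (ε / 4) (by positivity)
    refine ⟨min δ 1, by positivity, fun y hy => ?_⟩
    have hy1 : dist y x < δ := lt_of_lt_of_le hy (min_le_left _ _)
    have hy2 : dist y x < 1 := lt_of_lt_of_le hy (min_le_right _ _)
    rw [Real.dist_eq] at hy2
    have hy3 := abs_lt.1 hy2
    have b1 := hn x (by linarith)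
    have b2 := hn y (by linarith)
    have b3 := hδ' (show dist (y + τ n) (x + τ n) < δ by simpa using hy1)
    have b4 := dist_triangle4 (p y) (f (y + τ n)) (f (x + τ n)) (p x)
    rw [dist_comm (p y) (f (y + τ n))] at b4
    linarith
  · intro ε hε
    obtain ⟨l, hl, h⟩ := G (ε / 2) (by positivity)
    have hgood : ∀ ρ : ℝ, (∃ T, ∀ t ≥ T, dist (f (t + ρ)) (f t) ≤ ε / 2) →
        ∀ t, dist (p (t + ρ)) (p t) ≤ ε / 2 := by
      rintro ρ ⟨T, hT⟩ t
      refine le_of_tendsto ((hp (t + ρ)).dist (hp t)) ?_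
      filter_upwards [hτt.eventually_ge_atTop (T - t)] with n hn
      rw [add_right_comm]
      exact hT _ (by linarith)
    refine ⟨l, hl, fun a => ?_⟩
    by_cases ha : 0 ≤ a
    · obtain ⟨ρ, h1, h2⟩ := h a ha
      exact ⟨ρ, h1, fun t => lt_of_le_of_lt (hgood ρ h2 t) (half_lt_self hε)⟩
    by_cases hb : a + l ≤ 0
    · obtain ⟨ρ, h1, h2⟩ := h (-a - l) (by linarith)
      refine ⟨-ρ, ⟨by linarith [h1.2], by linarith [h1.1]⟩, fun t => ?_⟩
      have := hgood ρ h2 (t + -ρ)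
      rw [neg_add_cancel_right, dist_comm] at this
      linarith
    · exact ⟨0, ⟨by linarith, by linarith⟩, fun t => by simpa using hε⟩
  · rw [Metric.tendsto_atTop]
    intro ε hε
    obtain ⟨n0, hn0⟩ := hU 0 (ε / 3) (by positivity)
    obtain ⟨n, hn, T, hT⟩ := hper (ε / 3) (by positivity) n0
    refine ⟨max 0 T, fun t ht => ?_⟩
    have c1 := hn0 n hn t ((le_max_left _ _).trans ht)
    have c2 := hT t ((le_max_right _ _).trans ht)
    have c3 := dist_triangle_left (f t) (p t) (f (t + τ n))
    rw [Real.dist_eq, sub_zero, abs_of_nonneg dist_nonneg]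
    linarith

/-- Seifert–Fink characterization of asymptotic almost periodicity on `ℝ₊`:
`f` is asymptotically almost periodic iff from every positive sequence tending to
`+∞` one can extract a subsequence `α` with a separation constant `d(α) > 0` such that
`T_α f` exists pointwise on `ℝ₊`, and any two pointwise limits `h₁ = T_{δ+β} f`,
`h₂ = T_{δ+γ} f` (with `δ > 0` and `β, γ` subsequences of `α`) either coincide on
`ℝ₊` or stay at distance at least `2 d(α)` apart on `ℝ₊`. -/
theorem asymptoticallyAP_iff_separation {M : Type*} [MetricSpace M] [CompleteSpace M]
    (f : ℝ → M) (hf : ContinuousOn f (Set.Ici (0 : ℝ))) :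
    (∃ p : ℝ → M, Continuous p ∧ IsBohrAP p ∧
        Tendsto (fun t => dist (f t) (p t)) atTop (nhds 0)) ↔
      ∀ α' : ℕ → ℝ, (∀ n, 0 < α' n) → Tendsto α' atTop atTop →
        ∃ φ : ℕ → ℕ, StrictMono φ ∧ ∃ dα > (0 : ℝ),
          (∃ g : ℝ → M, ∀ t ≥ (0 : ℝ),
            Tendsto (fun n => f (t + α' (φ n))) atTop (nhds (g t))) ∧
          ∀ (δ : ℕ → ℝ) (ψ χ : ℕ → ℕ) (h₁ h₂ : ℝ → M),
            (∀ n, 0 < δ n) → StrictMono ψ → StrictMono χ →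
            (∀ t ≥ (0 : ℝ),
              Tendsto (fun n => f (t + (δ n + α' (φ (ψ n))))) atTop (nhds (h₁ t))) →
            (∀ t ≥ (0 : ℝ),
              Tendsto (fun n => f (t + (δ n + α' (φ (χ n))))) atTop (nhds (h₂ t))) →
            (∀ t ≥ (0 : ℝ), h₁ t = h₂ t) ∨
              (∀ t ≥ (0 : ℝ), 2 * dα ≤ dist (h₁ t) (h₂ t)) := by
  constructor
  · rintro ⟨p, hc, hp, hfp⟩ α' _ hα
    obtain ⟨φ, hφ, hg, h⟩ := fwd_dir f p hc hp hfp α' hα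
    exact ⟨φ, hφ, 1, one_pos, hg, fun δ ψ χ h₁ h₂ a b c d e =>
      Or.inl (h δ ψ χ h₁ h₂ a b c d e)⟩
  · intro H
    exact bwd_dir f hf (sep_uniform f hf H)
end

section
/- Let A be a constant real d × d matrix and let x : ℝ → ℝ^d be a differentiable function satisfying x'(t) = A x(t) for all t ∈ ℝ. If x is bounded on ℝ, i.e. sup_{t ∈ ℝ} |x(t)| < ∞, then x is Bohr almost periodic. -/
open Filter Topology Set

theorem flow_eq_aux {E : Type*} [NormedAddCommGroup E] [NormedSpace ℝ E] [CompleteSpace E]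
    (L : E →L[ℝ] E) (x : ℝ → E) (hx : ∀ t, HasDerivAt x (L (x t)) t) (t s : ℝ) :
    x (t + s) = NormedSpace.exp (s • L) (x t) := by
  have h1 : ∀ s : ℝ, HasDerivAt (fun s => x (t + s)) (L (x (t + s))) s := by
    intro s
    exact (hx (t + s)).comp_const_add t s
  have h2 : ∀ s : ℝ, HasDerivAt (fun s : ℝ => NormedSpace.exp (s • L) (x t))
      (L (NormedSpace.exp (s • L) (x t))) s := by
    intro s
    have h := (hasDerivAt_exp_smul_const' (𝕂 := ℝ) L s).clm_apply (hasDerivAt_const s (x t))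
    simpa using h
  have := ODE_solution_unique_univ (v := fun _ => L) (s := fun _ => Set.univ) (K := ‖L‖₊)
    (t₀ := 0) (f := fun s => x (t + s)) (g := fun s : ℝ => NormedSpace.exp (s • L) (x t))
    (fun _ => L.lipschitz.lipschitzOnWith) (fun s => ⟨h1 s, trivial⟩) (fun s => ⟨h2 s, trivial⟩)
    (by simp)
  exact congrFun this s

theorem finite_net_aux {G : Type*} [NormedAddCommGroup G] [NormedSpace ℝ G]
    [FiniteDimensional ℝ G] (U : ℝ → G) (B : ℝ) (hB : ∀ s, ‖U s‖ ≤ B) (δ : ℝ) (hδ : 0 < δ) :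
    ∃ F ⊆ Set.range U, F.Finite ∧ ∀ s, ∃ y ∈ F, ‖U s - y‖ < δ := by
  have : ProperSpace G := FiniteDimensional.proper ℝ G
  have hU : TotallyBounded (Set.range U) := by
    refine (isCompact_closedBall (0 : G) B).totallyBounded.subset ?_
    rintro _ ⟨s, rfl⟩
    simpa using hB s
  obtain ⟨F, hFsub, hFfin, hF⟩ := Metric.finite_approx_of_totallyBounded hU _ hδ
  refine ⟨F, hFsub, hFfin, fun s => ?_⟩
  simpa [dist_eq_norm] using hF ⟨s, rfl⟩

theorem bohr_aux {E : Type*} [NormedAddCommGroup E] [NormedSpace ℝ E] [FiniteDimensional ℝ E]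
    (L : E →L[ℝ] E) (x : ℝ → E) (hx : ∀ t, HasDerivAt x (L (x t)) t)
    (hbd : ∃ C : ℝ, ∀ t : ℝ, ‖x t‖ ≤ C) : IsBohrAP x := by
  have : CompleteSpace E := FiniteDimensional.complete ℝ E
  obtain ⟨C, hC⟩ := hbd
  have hC0 : 0 ≤ C := (norm_nonneg _).trans (hC 0)
  let W : Submodule ℝ E :=
    { carrier := {v | ∃ B : ℝ, ∀ s : ℝ, ‖NormedSpace.exp (s • L) v‖ ≤ B}
      zero_mem' := ⟨0, fun s => by simp⟩
      add_mem' := by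
        rintro v w ⟨B, hB⟩ ⟨B', hB'⟩
        refine ⟨B + B', fun s => ?_⟩
        rw [map_add]
        exact (norm_add_le _ _).trans (add_le_add (hB s) (hB' s))
      smul_mem' := by
        rintro c v ⟨B, hB⟩
        refine ⟨‖c‖ * B, fun s => ?_⟩
        rw [map_smul, norm_smul]
        exact mul_le_mul_of_nonneg_left (hB s) (norm_nonneg _) }
  have hW : ∀ t, x t ∈ W := fun t => ⟨C, fun s => by
    rw [← flow_eq_aux L x hx]; exact hC _⟩
  have : CompleteSpace W := FiniteDimensional.complete ℝ W
  let U : ℝ → (W →L[ℝ] E) := fun s => (NormedSpace.exp (s • L)).comp W.subtypeL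
  obtain ⟨B, hB⟩ : ∃ B, ∀ s, ‖U s‖ ≤ B := banach_steinhaus (fun v => v.2)
  intro ε hε
  have hδ : 0 < ε / (C + 1) := by positivity
  obtain ⟨F, hFsub, hFfin, hF⟩ := finite_net_aux U B hB _ hδ
  have hFsub2 : ∀ y, y ∈ F → ∃ s, U s = y := fun y hy => hFsub hy
  choose! σ hσ using hFsub2
  obtain ⟨R, hR⟩ : ∃ R : ℝ, ∀ y ∈ F, |σ y| ≤ R := by
    obtain ⟨R, hR⟩ := (hFfin.image (fun y => |σ y|)).bddAbove
    exact ⟨R, fun y hy => hR ⟨y, hy, rfl⟩⟩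
  have hR' : ∀ y ∈ F, |σ y| < |R| + 1 := fun y hy =>
    lt_of_le_of_lt ((hR y hy).trans (le_abs_self R)) (by linarith)
  refine ⟨2 * (|R| + 1), by positivity, fun a => ?_⟩
  obtain ⟨y, hy, hd⟩ : ∃ y ∈ F, ‖U (a + (|R| + 1)) - y‖ < ε / (C + 1) :=
    hF (a + (|R| + 1))
  have h3 := abs_lt.1 (hR' y hy)
  refine ⟨a + (|R| + 1) - σ y, ⟨by linarith, by linarith⟩, fun t => ?_⟩
  rw [← hσ y hy] at hd
  have key : ∀ s, x ((t - σ y) + s) = U s ⟨x (t - σ y), hW _⟩ := fun s => flow_eq_aux L x hx _ s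
  have e1 : t + (a + (|R| + 1) - σ y) = (t - σ y) + (a + (|R| + 1)) := by ring
  have e2 : x t = x ((t - σ y) + σ y) := by congr 1; ring
  rw [e1, e2, key, key, dist_eq_norm, ← sub_apply]
  refine lt_of_le_of_lt (ContinuousLinearMap.le_opNorm _ _) ?_
  have h4 : ‖(⟨x (t - σ y), hW _⟩ : W)‖ ≤ C := hC _
  calc _ ≤ ‖U (a + (|R| + 1)) - U (σ y)‖ * (C + 1) :=
        mul_le_mul_of_nonneg_left (by linarith) (ContinuousLinearMap.opNorm_nonneg _)
    _ < ε / (C + 1) * (C + 1) := by gcongr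
    _ = ε := by field_simp

/-- Every bounded solution on `ℝ` of the constant-coefficient linear equation
`x' = A x` is Bohr almost periodic. -/
theorem bounded_solution_linear_const_isBohrAP {d : ℕ}
    (A : Matrix (Fin d) (Fin d) ℝ) (x : ℝ → EuclideanSpace ℝ (Fin d))
    (hsol : ∀ t : ℝ, HasDerivAt x (Matrix.toEuclideanLin A (x t)) t)
    (hbd : ∃ C : ℝ, ∀ t : ℝ, ‖x t‖ ≤ C) :
    Continuous x ∧ IsBohrAP x := by
  refine ⟨continuous_iff_continuousAt.2 fun t => (hsol t).continuousAt, ?_⟩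
  exact bohr_aux (LinearMap.toContinuousLinearMap (Matrix.toEuclideanLin A)) x hsol hbd
end

section
/- Let A be a constant real d × d matrix and let x : ℝ → ℝ^d be a differentiable function satisfying x'(t) = A x(t) for all t ∈ ℝ, with sup_{t ∈ ℝ} |x(t)| < ∞. If x is not identically zero, then inf_{t ∈ ℝ} |x(t)| > 0; that is, every nontrivial bounded solution of the constant-coefficient homogeneous linear equation is separated from zero. -/
open Filter Topology Set

/-- Solutions are given by the exponential flow. -/
lemma flow_eq {E : Type*} [NormedAddCommGroup E] [NormedSpace ℝ E] [CompleteSpace E]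
    (L : E →L[ℝ] E) (x : ℝ → E) (hsol : ∀ t, HasDerivAt x (L (x t)) t) (t s : ℝ) :
    NormedSpace.exp (s • L) (x t) = x (t + s) := by
  have h := ODE_solution_unique_univ (v := fun _ y => L y) (s := fun _ => univ) (K := ‖L‖₊)
    (f := fun s => NormedSpace.exp (s • L) (x t)) (g := fun s => x (t + s)) (t₀ := 0)
    (fun _ => L.lipschitz.lipschitzOnWith)
    (fun s => ⟨by
      have h1 := (hasDerivAt_exp_smul_const' (𝕂 := ℝ) L s).clm_apply (hasDerivAt_const s (x t))
      simpa using h1, mem_univ _⟩)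
    (fun s => ⟨(hsol (t + s)).comp_const_add t s, mem_univ _⟩)
    (by simp)
  exact congrFun h s

/-- The subspace of initial values with bounded orbit. -/
def bddSub {E : Type*} [NormedAddCommGroup E] [NormedSpace ℝ E]
    (F : ℝ → E →L[ℝ] E) : Submodule ℝ E where
  carrier := {v | ∃ C : ℝ, ∀ t, ‖F t v‖ ≤ C}
  zero_mem' := ⟨0, fun t => by simp⟩
  add_mem' := by
    rintro a b ⟨C, hC⟩ ⟨D, hD⟩
    refine ⟨C + D, fun t => ?_⟩
    rw [map_add]
    exact (norm_add_le _ _).trans (add_le_add (hC t) (hD t))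
  smul_mem' := by
    rintro c a ⟨C, hC⟩
    refine ⟨‖c‖ * C, fun t => ?_⟩
    rw [map_smul, norm_smul]
    exact mul_le_mul_of_nonneg_left (hC t) (norm_nonneg _)

/-- Every nontrivial bounded solution on `ℝ` of the constant-coefficient homogeneous
linear equation `x' = A x` is separated from zero: `inf_{t ∈ ℝ} |x(t)| > 0`. -/
theorem bounded_solution_linear_const_separated_from_zero {d : ℕ}
    (A : Matrix (Fin d) (Fin d) ℝ) (x : ℝ → EuclideanSpace ℝ (Fin d))
    (hsol : ∀ t : ℝ, HasDerivAt x (Matrix.toEuclideanLin A (x t)) t)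
    (hbd : ∃ C : ℝ, ∀ t : ℝ, ‖x t‖ ≤ C)
    (hnontriv : ¬ ∀ t : ℝ, x t = 0) :
    ∃ c > 0, ∀ t : ℝ, c ≤ ‖x t‖ := by
  obtain ⟨C, hC⟩ := hbd
  push Not at hnontriv
  obtain ⟨t₀, ht₀⟩ := hnontriv
  set L := LinearMap.toContinuousLinearMap (Matrix.toEuclideanLin A) with hL
  have hflow := flow_eq L x hsol
  set F : ℝ → EuclideanSpace ℝ (Fin d) →L[ℝ] EuclideanSpace ℝ (Fin d) :=
    fun s => NormedSpace.exp (s • L) with hF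
  have hmem : ∀ t, x t ∈ bddSub F := fun t => ⟨C, fun s => by
    have := hflow t s
    simp only [hF]
    rw [this]; exact hC _⟩
  obtain ⟨K, hK⟩ := banach_steinhaus (g := fun t => (F t).comp (bddSub F).subtypeL)
    (fun v => v.2)
  have key : ∀ t, ‖x t₀‖ ≤ (|K| + 1) * ‖x t‖ := fun t => by
    have h1 := ((F (t₀ - t)).comp (bddSub F).subtypeL).le_of_opNorm_le (hK (t₀ - t)) ⟨x t, hmem t⟩
    have h2 : F (t₀ - t) (x t) = x t₀ := by
      have := hflow t (t₀ - t)
      simpa using this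
    have h3 : ‖F (t₀ - t) (x t)‖ ≤ K * ‖x t‖ := h1
    rw [h2] at h3
    refine h3.trans (mul_le_mul_of_nonneg_right ?_ (norm_nonneg _))
    linarith [le_abs_self K]
  have hpos : 0 < |K| + 1 := by positivity
  refine ⟨‖x t₀‖ / (|K| + 1), div_pos (norm_pos_iff.2 ht₀) hpos, fun t => ?_⟩
  rw [div_le_iff₀' hpos]
  exact key t
end

section
/- Let (M₁,d₁) and (M₂,d₂) be complete metric spaces and let f : ℝ → M₁ and g : ℝ → M₂ be Bohr almost periodic functions. Then the function h : ℝ → M₁ × M₂ defined by h(t) = (f(t), g(t)) is Bohr almost periodic, where M₁ × M₂ carries the metric d((x₁,x₂),(y₁,y₂)) = max(d₁(x₁,y₁), d₂(x₂,y₂)). In particular, for every ε > 0 the set of common ε-almost periods {τ ∈ ℝ : sup_{t ∈ ℝ} d₁(f(t+τ), f(t)) < ε and sup_{t ∈ ℝ} d₂(g(t+τ), g(t)) < ε} is relatively dense in ℝ. -/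
open Filter Topology Set

theorem IsBohrAP.unifCont {M : Type*} [PseudoMetricSpace M] {f : ℝ → M}
    (hfc : Continuous f) (hf : IsBohrAP f) :
    ∀ ε > 0, ∃ δ > 0, ∀ x y : ℝ, |x - y| < δ → dist (f x) (f y) < ε := by
  intro ε hε
  obtain ⟨l, hl, h⟩ := hf (ε / 3) (by positivity)
  have huc : UniformContinuousOn f (Set.Icc (-1) (l + 1)) :=
    isCompact_Icc.uniformContinuousOn_of_continuous hfc.continuousOn
  obtain ⟨δ, hδ, hu⟩ := Metric.uniformContinuousOn_iff.1 huc (ε / 3) (by positivity)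
  refine ⟨min δ 1, by positivity, fun x y hxy => ?_⟩
  obtain ⟨τ, ⟨h1, h2⟩, hτ⟩ := h (-x)
  have hxy1 : |x - y| < δ := lt_of_lt_of_le hxy (min_le_left _ _)
  have hxy2 := abs_lt.1 (lt_of_lt_of_le hxy (min_le_right _ _))
  have hm := hu (x + τ) ⟨by linarith, by linarith⟩ (y + τ) ⟨by linarith, by linarith⟩
    (by rw [Real.dist_eq]; simpa using hxy1)
  have hx := hτ x
  have hy := hτ y
  rw [dist_comm] at hx
  have := dist_triangle4 (f x) (f (x + τ)) (f (y + τ)) (f y)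
  linarith

theorem RelativelyDense.enlarge {T : Set ℝ} (hT : RelativelyDense T) :
    ∃ l > 0, ∀ l' ≥ l, ∀ a : ℝ, ∃ τ ∈ Set.Ioo a (a + l'), τ ∈ T := by
  obtain ⟨l, hl, h⟩ := hT
  refine ⟨l, hl, fun l' hl' a => ?_⟩
  obtain ⟨τ, ⟨h1, h2⟩, hτ⟩ := h a
  exact ⟨τ, ⟨h1, by linarith⟩, hτ⟩

theorem period_sub {M : Type*} [PseudoMetricSpace M] {f : ℝ → M} {ε τ σ : ℝ}
    (hτ : ∀ t, dist (f (t + τ)) (f t) < ε) (hσ : ∀ t, dist (f (t + σ)) (f t) < ε) (t : ℝ) :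
    dist (f (t + (τ - σ))) (f t) < 2 * ε := by
  have h1 := hτ (t - σ)
  have h2 := hσ (t - σ)
  rw [sub_add_cancel, dist_comm] at h2
  rw [show t - σ + τ = t + (τ - σ) by ring] at h1
  rw [dist_comm] at h2
  have := dist_triangle_right (f (t + (τ - σ))) (f t) (f (t - σ))
  linarith

theorem common_periods {M₁ M₂ : Type*} [PseudoMetricSpace M₁] [PseudoMetricSpace M₂]
    (f : ℝ → M₁) (g : ℝ → M₂)
    (hf : IsBohrAP f) (hgc : Continuous g) (hg : IsBohrAP g) (ε : ℝ) (hε : 0 < ε) :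
    RelativelyDense
        {τ : ℝ | (∀ t : ℝ, dist (f (t + τ)) (f t) < ε) ∧
                 (∀ t : ℝ, dist (g (t + τ)) (g t) < ε)} := by
  obtain ⟨δ, hδ, hu⟩ := IsBohrAP.unifCont hgc hg (ε / 3) (by positivity)
  obtain ⟨l₁, hl₁, h₁⟩ := (hf (ε / 3) (by positivity)).enlarge
  obtain ⟨l₂, hl₂, h₂⟩ := (hg (ε / 3) (by positivity)).enlarge
  obtain ⟨l, hl, hle₁, hle₂⟩ : ∃ l > 0, l₁ ≤ l ∧ l₂ ≤ l :=
    ⟨max l₁ l₂, lt_max_of_lt_left hl₁, le_max_left _ _, le_max_right _ _⟩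
  choose τ hτI hτ using h₁ l hle₁
  choose σ hσI hσ using h₂ l hle₂
  let c : ℝ → ℤ := fun a => ⌊(τ a - σ a) / δ⌋
  have hfin : (Set.range c).Finite := by
    refine (Set.finite_Icc ⌊(-l) / δ⌋ ⌊l / δ⌋).subset ?_
    rintro _ ⟨a, rfl⟩
    have h1 := hτI a
    have h2 := hσI a
    constructor
    · apply Int.floor_le_floor
      gcongr
      linarith [h1.1, h2.2]
    · apply Int.floor_le_floor
      gcongr
      linarith [h1.2, h2.1]
  have hex : ∀ k : ℤ, ∃ b : ℝ, k ∈ Set.range c → c b = k := by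
    intro k
    by_cases hk : k ∈ Set.range c
    · obtain ⟨b, hb⟩ := hk
      exact ⟨b, fun _ => hb⟩
    · exact ⟨0, fun h => absurd h hk⟩
  choose r hr using hex
  obtain ⟨B, hB⟩ := ((hfin.image r).isBounded).exists_norm_le
  have hB' : ∀ a, |r (c a)| ≤ B := fun a => hB _ ⟨c a, ⟨a, rfl⟩, rfl⟩
  have hB0 : 0 ≤ B := (abs_nonneg _).trans (hB' 0)
  refine ⟨2 * B + 2 * l, by positivity, fun a => ?_⟩
  let a' := a + B + l
  obtain ⟨b, hbB, hbc⟩ : ∃ b, |b| ≤ B ∧ c b = c a' := ⟨r (c a'), hB' a', hr _ ⟨a', rfl⟩⟩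
  have hb := abs_le.1 hbB
  have i1 := hτI a'
  have i2 := hτI b
  have ea : a' = a + B + l := rfl
  refine ⟨τ a' - τ b, ⟨by linarith [i1.1, i2.2], by linarith [i1.2, i2.1]⟩, ?_, ?_⟩
  · intro t
    have := period_sub (hτ a') (hτ b) t
    linarith
  · intro t
    have h1 := period_sub (hσ a') (hσ b) t
    have h3 := Int.abs_sub_lt_one_of_floor_eq_floor hbc
    have h4 : |(τ b - σ b) - (τ a' - σ a')| < δ := by
      rw [← sub_div, abs_div, abs_of_pos hδ, div_lt_one hδ] at h3
      exact h3
    have h2 := hu (t + (τ a' - τ b)) (t + (σ a' - σ b)) (by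
      rw [abs_sub_comm]
      convert h4 using 2
      ring)
    have := dist_triangle (g (t + (τ a' - τ b))) (g (t + (σ a' - σ b))) (g t)
    linarith

/-- If `f : ℝ → M₁` and `g : ℝ → M₂` are Bohr almost periodic, then
`h(t) = (f(t), g(t))` is Bohr almost periodic for the sup (max) metric on `M₁ × M₂`;
in particular, for every `ε > 0` the set of common `ε`-almost periods of `f` and `g`
is relatively dense in `ℝ`. (In Mathlib the product metric is the max metric:
`dist (x, y) (x', y') = max (dist x x') (dist y y')`.) -/
theorem bohrAP_pair {M₁ M₂ : Type*} [MetricSpace M₁] [CompleteSpace M₁]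
    [MetricSpace M₂] [CompleteSpace M₂]
    (f : ℝ → M₁) (g : ℝ → M₂)
    (hfc : Continuous f) (hf : IsBohrAP f) (hgc : Continuous g) (hg : IsBohrAP g) :
    (Continuous (fun t : ℝ => (f t, g t)) ∧ IsBohrAP (fun t : ℝ => (f t, g t))) ∧
      ∀ ε > 0, RelativelyDense
        {τ : ℝ | (∀ t : ℝ, dist (f (t + τ)) (f t) < ε) ∧
                 (∀ t : ℝ, dist (g (t + τ)) (g t) < ε)} := by
  refine ⟨⟨hfc.prodMk hgc, fun ε hε => ?_⟩, fun ε hε => common_periods f g hf hgc hg ε hε⟩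
  obtain ⟨l, hl, h⟩ := common_periods f g hf hgc hg ε hε
  refine ⟨l, hl, fun a => ?_⟩
  obtain ⟨τ, hI, h1, h2⟩ := h a
  refine ⟨τ, hI, fun t => ?_⟩
  rw [Prod.dist_eq]
  exact max_lt (h1 t) (h2 t)
end
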